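/- Let op_0 op_1 ... op_n be a valid sequence of order-2 stack operations. Then for every 0 ≤ j ≤ n there is at most one index 0 ≤ i ≤ j such that op_i ... op_j ∈ L1, and at most one index 0 ≤ i ≤ j such that op_i ... op_j ∈ L2. -/

import Mathlib

/-- Order-2 stack operations over stack alphabet `S`. -/
inductive Op (S : Type) : Type where
  | push1 : S → Op S
  | pop1  : Op S
  | push2 : Op S
  | pop2  : Op S
  | collapse : Op S
  deriving DecidableEq

/-- Annotated stack symbol: (symbol, collapse link, position annotation). -/
abbrev ASym (S : Type) : Type := S × ℕ × ℤ
/-- Annotated order-1 stack, topmost symbol first. -/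
abbrev Stk1 (S : Type) : Type := List (ASym S)
/-- Annotated order-2 stack: list of (position annotation, order-1 stack), topmost first.
In `[[u_1][u_2] ⋯ [u_n]]` the topmost stack `u_n` comes first in the list. -/
abbrev Stk2 (S : Type) : Type := List (ℤ × Stk1 S)

/-- The initial order-2 stack `[[]]`, its unique (empty) order-1 stack annotated `-1`. -/
def initStk (S : Type) : Stk2 S := [(-1, ([] : Stk1 S))]

/-- One step of the annotated semantics; `p` is the current position.
`push1 s` records the collapse link `n-1` (number of stacks below the top) and the
position annotation `p`; `push2` duplicates the top stack annotating the copy with `p`;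
`collapse` keeps the bottom `i` order-1 stacks, where `i` is the collapse link of the
topmost symbol.  Undefined operations yield `none`. -/
def step {S : Type} (p : ℕ) (op : Op S) (W : Stk2 S) : Option (Stk2 S) :=
  match op, W with
  | .push2, t :: rest => some (((p : ℤ), t.2) :: t :: rest)
  | .pop2, _ :: t :: rest => some (t :: rest)
  | .push1 s, (a, u) :: rest => some ((a, (s, rest.length, (p : ℤ)) :: u) :: rest)
  | .pop1, (a, _ :: u) :: rest => some ((a, u) :: rest)
  | .collapse, (_, (_, i, _) :: _) :: _ =>
      if 1 ≤ i ∧ i < W.length then some (W.drop (W.length - i)) else none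
  | _, _ => none

def runFrom {S : Type} (p : ℕ) (W : Stk2 S) : List (Op S) → Option (Stk2 S)
  | [] => some W
  | op :: rest => (step p op W).bind fun W' => runFrom (p + 1) W' rest

/-- `stkAt ops j` is the annotated order-2 stack `W_j` after executing `op_0 ⋯ op_j`
(for `j = -1` this is the initial stack `[[]]`). -/
def stkAt {S : Type} (ops : List (Op S)) (j : ℤ) : Option (Stk2 S) :=
  runFrom 0 (initStk S) (ops.take (j + 1).toNat)

/-- A nonempty sequence of operations is valid if every operation is defined,
starting from the empty order-2 stack `[[]]`. -/
def Valid {S : Type} (ops : List (Op S)) : Prop :=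
  ops ≠ [] ∧ (runFrom 0 (initStk S) ops).isSome

/-- `push1At ops j` is `push1(j)`: the position annotation of the topmost symbol of the
topmost order-1 stack of `W_j`, or `-1` if that stack is empty (also `-1` for `j = -1`). -/
def push1At {S : Type} (ops : List (Op S)) (j : ℤ) : ℤ :=
  match stkAt ops j with
  | some ((_, (_, _, p) :: _) :: _) => p
  | _ => -1

/-- `Push2At ops j` is `Push2(j)`: the position annotation of the topmost order-1 stack
of `W_j` (`-1` for `j = -1`). -/
def Push2At {S : Type} (ops : List (Op S)) (j : ℤ) : ℤ :=
  match stkAt ops j with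
  | some ((a, _) :: _) => a
  | _ => -1

mutual
/-- Words derived from the nonterminal `S1` of the grammar
`S1 → ↑1 | S1 ↑2 | S1 S1 ↓1 | S1 S2 ↓2 | S1 S2 S1 ⇓`
(all letters `↑1(s)` are identified with the single letter `↑1`). -/
inductive InL1 {S : Type} : List (Op S) → Prop where
  | base (s : S) : InL1 [Op.push1 s]
  | push2 (w : List (Op S)) : InL1 w → InL1 (w ++ [Op.push2])
  | pop1 (v w : List (Op S)) : InL1 v → InL1 w → InL1 (v ++ w ++ [Op.pop1])
  | pop2 (v w : List (Op S)) : InL1 v → InL2 w → InL1 (v ++ w ++ [Op.pop2])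
  | collapse (v w x : List (Op S)) : InL1 v → InL2 w → InL1 x →
      InL1 (v ++ w ++ x ++ [Op.collapse])

/-- Words derived from the nonterminal `S2` of the grammar
`S2 → ↑2 | S2 ↑1 | S2 ↓1 | S2 S2 ↓2 | S2 S2 S1 ⇓`. -/
inductive InL2 {S : Type} : List (Op S) → Prop where
  | base : InL2 [Op.push2]
  | push1 (s : S) (w : List (Op S)) : InL2 w → InL2 (w ++ [Op.push1 s])
  | pop1 (w : List (Op S)) : InL2 w → InL2 (w ++ [Op.pop1])
  | pop2 (v w : List (Op S)) : InL2 v → InL2 w → InL2 (v ++ w ++ [Op.pop2])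
  | collapse (v w x : List (Op S)) : InL2 v → InL2 w → InL1 x →
      InL2 (v ++ w ++ x ++ [Op.collapse])
end

/-- The factor `op_i ⋯ op_j` of the sequence. -/
def factor {S : Type} (ops : List (Op S)) (i j : ℕ) : List (Op S) :=
  (ops.drop i).take (j + 1 - i)

/-- Run from the initial stack. -/
def run0 {S : Type} (l : List (Op S)) : Option (Stk2 S) := runFrom 0 (initStk S) l

theorem runFrom_append {S : Type} (l m : List (Op S)) : ∀ (p : ℕ) (W : Stk2 S),
    runFrom p W (l ++ m) = (runFrom p W l).bind fun W' => runFrom (p + l.length) W' m := by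
  induction l with
  | nil => intro p W; simp [runFrom]
  | cons o l ih =>
    intro p W
    simp only [List.cons_append, runFrom, List.length_cons]
    cases h : step p o W with
    | none => rfl
    | some W' =>
      simp only [Option.bind_some]
      rw [ih]
      congr 1
      funext W''
      congr 1
      omega

theorem run0_snoc {S : Type} (l : List (Op S)) (o : Op S) :
    run0 (l ++ [o]) = (run0 l).bind (step l.length o) := by
  unfold run0
  rw [runFrom_append]
  congr 1
  funext W
  simp only [runFrom, Nat.zero_add]
  cases step l.length o W <;> rfl

theorem run0_prefix {S : Type} (l m : List (Op S)) (h : (run0 (l ++ m)).isSome) :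
    (run0 l).isSome := by
  unfold run0 at *
  rw [runFrom_append] at h
  cases h' : runFrom 0 (initStk S) l with
  | none => simp [h'] at h
  | some W => rfl

/-- Order-2 annotations point to the moment at which the stacks below were the whole stack. -/
def GoodA {S : Type} (l : List (Op S)) (a : ℤ) (rest : Stk2 S) : Prop :=
  a = -1 ∨ ∃ l', l' <+: l ∧ a = (l'.length : ℤ) ∧ run0 l' = some rest

/-- Order-1 annotations point to the moment just before the symbol was pushed. -/
def GoodB {S : Type} (l : List (Op S)) (n : ℕ) (b : ℤ) (v : Stk1 S) (rest : Stk2 S) : Prop :=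
  ∃ l' a' rest', l' <+: l ∧ b = (l'.length : ℤ) ∧ run0 l' = some ((a', v) :: rest') ∧
    n = rest'.length ∧ rest' <:+ rest

def GoodU {S : Type} (l : List (Op S)) (u : Stk1 S) (rest : Stk2 S) : Prop :=
  ∀ s n b v, (s, n, b) :: v <:+ u → GoodB l n b v rest

def Good {S : Type} (l : List (Op S)) (W : Stk2 S) : Prop :=
  ∀ a u rest, (a, u) :: rest <:+ W → GoodA l a rest ∧ GoodU l u rest

theorem GoodU.mono {S : Type} {l l' : List (Op S)} {u u' : Stk1 S} {r r' : Stk2 S}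
    (h : GoodU l u r) (hl : l <+: l') (hu : u' <:+ u) (hr : r <:+ r') : GoodU l' u' r' := by
  intro s n b v hs
  obtain ⟨l1, a', rest', h1, h2, h3, h4, h5⟩ := h s n b v (hs.trans hu)
  exact ⟨l1, a', rest', h1.trans hl, h2, h3, h4, h5.trans hr⟩

theorem GoodA.mono {S : Type} {l l' : List (Op S)} {a : ℤ} {r : Stk2 S}
    (h : GoodA l a r) (hl : l <+: l') : GoodA l' a r := by
  rcases h with h | ⟨l1, h1, h2⟩
  · exact Or.inl h
  · exact Or.inr ⟨l1, h1.trans hl, h2⟩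

theorem Good.mono {S : Type} {l l' : List (Op S)} {W W' : Stk2 S}
    (h : Good l W) (hl : l <+: l') (hW : W' <:+ W) : Good l' W' := by
  intro a u rest hs
  obtain ⟨h1, h2⟩ := h a u rest (hs.trans hW)
  exact ⟨h1.mono hl, h2.mono hl (List.suffix_refl _) (List.suffix_refl _)⟩

theorem Good.cons {S : Type} {l : List (Op S)} {a : ℤ} {u : Stk1 S} {W : Stk2 S}
    (h : Good l W) (ha : GoodA l a W) (hu : GoodU l u W) : Good l ((a, u) :: W) := by
  intro a' u' rest hs
  rcases List.suffix_cons_iff.1 hs with h' | h'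
  · simp only [List.cons.injEq, Prod.mk.injEq] at h'
    obtain ⟨⟨rfl, rfl⟩, rfl⟩ := h'
    exact ⟨ha, hu⟩
  · exact h _ _ _ h'

theorem good_run {S : Type} (l : List (Op S)) : ∀ W, run0 l = some W → Good l W := by
  induction l using List.reverseRecOn with
  | nil =>
    intro W h
    simp only [run0, runFrom, Option.some.injEq] at h
    subst h
    refine Good.cons ?_ (Or.inl rfl) ?_
    · intro a u rest hs; simp at hs
    · intro s n b v hs; simp at hs
  | append_singleton l o ih =>
    intro W' h
    rw [run0_snoc] at h
    cases hW : run0 l with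
    | none => simp [hW] at h
    | some W =>
      have hg := ih W hW
      have hp : l <+: l ++ [o] := List.prefix_append _ _
      rw [hW, Option.bind_some] at h
      cases W with
      | nil => cases o <;> simp [step] at h
      | cons t rest =>
        obtain ⟨a, u⟩ := t
        obtain ⟨gA, gU⟩ := hg a u rest (List.suffix_refl _)
        have hr : Good (l ++ [o]) rest := hg.mono hp (List.suffix_cons _ _)
        cases o with
        | push1 s =>
          simp only [step, Option.some.injEq] at h
          subst h
          refine Good.cons hr (gA.mono hp) ?_
          intro s' n b v hs
          rcases List.suffix_cons_iff.1 hs with h' | h'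
          · simp only [List.cons.injEq, Prod.mk.injEq] at h'
            obtain ⟨⟨rfl, rfl, rfl⟩, rfl⟩ := h'
            exact ⟨l, a, rest, hp, rfl, hW, rfl, List.suffix_refl _⟩
          · exact (gU.mono hp (List.suffix_refl _) (List.suffix_refl _)) _ _ _ _ h'
        | pop1 =>
          cases u with
          | nil => simp [step] at h
          | cons c u =>
            simp only [step, Option.some.injEq] at h
            subst h
            exact Good.cons hr (gA.mono hp)
              (gU.mono hp (List.suffix_cons _ _) (List.suffix_refl _))
        | push2 =>
          simp only [step, Option.some.injEq] at h
          subst h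
          exact Good.cons (hg.mono hp (List.suffix_refl _)) (Or.inr ⟨l, hp, rfl, hW⟩)
            (gU.mono hp (List.suffix_refl _) (List.suffix_cons _ _))
        | pop2 =>
          cases rest with
          | nil => simp [step] at h
          | cons t rest =>
            simp only [step, Option.some.injEq] at h
            subst h
            exact hr
        | collapse =>
          cases u with
          | nil => simp [step] at h
          | cons c u =>
            obtain ⟨s, n, b⟩ := c
            simp only [step] at h
            split at h
            · simp only [Option.some.injEq] at h
              subst h
              exact hg.mono hp (List.drop_suffix _ _)
            · simp at h

def Top1 {S : Type} (l m : List (Op S)) : Prop :=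
  ∃ a s n v rest, run0 m = some ((a, (s, n, (l.length : ℤ)) :: v) :: rest)

def Top2 {S : Type} (l m : List (Op S)) : Prop :=
  ∃ u rest, run0 m = some (((l.length : ℤ), u) :: rest)

theorem prefix_eq {S : Type} {l l' m : List (Op S)} (h : l <+: m) (h' : l' <+: m)
    (hl : (l.length : ℤ) = l'.length) : l' = l := by
  have : l.length = l'.length := by exact_mod_cast hl
  exact ((List.prefix_of_prefix_length_le h h' this.le).eq_of_length this).symm

theorem pop1_run {S : Type} {l m : List (Op S)} (hlm : l <+: m) (h : Top1 l m) :
    ∃ a a' u rest rest', run0 l = some ((a, u) :: rest) ∧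
      run0 (m ++ [Op.pop1]) = some ((a', u) :: rest') := by
  obtain ⟨a, s, n, v, rest, h⟩ := h
  obtain ⟨l', a', rest', h1, h2, h3, h4, h5⟩ :=
    (good_run m _ h a _ rest (List.suffix_refl _)).2 s n _ v (List.suffix_refl _)
  obtain rfl := prefix_eq hlm h1 h2
  exact ⟨a', a, v, rest', rest, h3, by rw [run0_snoc, h]; rfl⟩

theorem pop2_eq {S : Type} {l m : List (Op S)} (hlm : l <+: m) {u : Stk1 S} {rest : Stk2 S}
    (h : run0 m = some (((l.length : ℤ), u) :: rest)) : run0 l = some rest := by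
  rcases (good_run m _ h _ _ rest (List.suffix_refl _)).1 with h' | ⟨l', h1, h2, h3⟩
  · omega
  · obtain rfl := prefix_eq hlm h1 h2
    exact h3

theorem pop2_run {S : Type} {l m : List (Op S)} (hlm : l <+: m) (h : Top2 l m)
    (hs : (run0 (m ++ [Op.pop2])).isSome) : run0 (m ++ [Op.pop2]) = run0 l := by
  obtain ⟨u, rest, h⟩ := h
  rw [pop2_eq hlm h]
  rw [run0_snoc, h] at hs ⊢
  cases rest with
  | nil => simp [step] at hs
  | cons t rest => rfl

theorem collapse_run {S : Type} {l k m : List (Op S)} (hlk : l <+: k) (hkm : k <+: m)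
    (h : Top2 l k) (h' : Top1 k m)
    (hs : (run0 (m ++ [Op.collapse])).isSome) : run0 (m ++ [Op.collapse]) = run0 l := by
  obtain ⟨u, rest, h⟩ := h
  obtain ⟨a, s, n, v, rest1, hm⟩ := h'
  obtain ⟨l', a', rest', h1, h2, h3, h4, h5⟩ :=
    (good_run m _ hm a _ rest1 (List.suffix_refl _)).2 s n _ v (List.suffix_refl _)
  obtain rfl := prefix_eq hkm h1 h2
  rw [h] at h3
  simp only [Option.some.injEq, List.cons.injEq, Prod.mk.injEq] at h3
  obtain ⟨⟨rfl, rfl⟩, rfl⟩ := h3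
  rw [pop2_eq hlk h]
  rw [run0_snoc, hm] at hs ⊢
  simp only [Option.bind_some, step] at hs ⊢
  split at hs
  · rename_i hc
    rw [if_pos hc, h4]
    congr 1
    exact (List.suffix_iff_eq_drop.1 (h5.trans (List.suffix_cons _ _))).symm
  · simp at hs

mutual
theorem top1_of {S : Type} {w : List (Op S)} (hw : InL1 w) (l : List (Op S))
    (hs : (run0 (l ++ w)).isSome) : Top1 l (l ++ w) := by
  cases hw with
  | base s =>
    rw [run0_snoc] at hs
    unfold Top1
    rw [run0_snoc]
    cases hW : run0 l with
    | none => simp [hW] at hs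
    | some W =>
      cases W with
      | nil => simp [hW, step] at hs
      | cons t rest => exact ⟨_, _, _, _, _, rfl⟩
  | push2 w hw =>
    rw [← List.append_assoc] at hs ⊢
    obtain ⟨a, s, n, v, rest, h⟩ := top1_of hw l (run0_prefix _ _ hs)
    unfold Top1
    rw [run0_snoc, h]
    exact ⟨_, _, _, _, _, rfl⟩
  | pop1 v w hv hw =>
    simp only [← List.append_assoc] at hs ⊢
    have hs1 := run0_prefix _ _ hs
    obtain ⟨a, s, n, x, rest, h⟩ := top1_of hv l (run0_prefix _ _ hs1)
    obtain ⟨b, b', u, r, r', h1, h2⟩ :=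
      pop1_run (List.prefix_append _ _) (top1_of hw (l ++ v) hs1)
    rw [h] at h1
    simp only [Option.some.injEq, List.cons.injEq, Prod.mk.injEq] at h1
    obtain ⟨⟨rfl, rfl⟩, rfl⟩ := h1
    exact ⟨_, _, _, _, _, h2⟩
  | pop2 v w hv hw =>
    simp only [← List.append_assoc] at hs ⊢
    have hs1 := run0_prefix _ _ hs
    have h := top1_of hv l (run0_prefix _ _ hs1)
    unfold Top1 at h ⊢
    rw [pop2_run (List.prefix_append _ _) (top2_of hw (l ++ v) hs1) hs]
    exact h
  | collapse v w x hv hw hx =>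
    simp only [← List.append_assoc] at hs ⊢
    have hs1 := run0_prefix _ _ hs
    have hs2 := run0_prefix _ _ hs1
    have h := top1_of hv l (run0_prefix _ _ hs2)
    unfold Top1 at h ⊢
    rw [collapse_run (List.prefix_append _ _) (List.prefix_append _ _)
      (top2_of hw (l ++ v) hs2) (top1_of hx (l ++ v ++ w) hs1) hs]
    exact h
  termination_by w.length
  decreasing_by all_goals (subst_vars; simp; try omega)

theorem top2_of {S : Type} {w : List (Op S)} (hw : InL2 w) (l : List (Op S))
    (hs : (run0 (l ++ w)).isSome) : Top2 l (l ++ w) := by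
  cases hw with
  | base =>
    rw [run0_snoc] at hs
    unfold Top2
    rw [run0_snoc]
    cases hW : run0 l with
    | none => simp [hW] at hs
    | some W =>
      cases W with
      | nil => simp [hW, step] at hs
      | cons t rest => exact ⟨_, _, rfl⟩
  | push1 s w hw =>
    rw [← List.append_assoc] at hs ⊢
    obtain ⟨u, rest, h⟩ := top2_of hw l (run0_prefix _ _ hs)
    unfold Top2
    rw [run0_snoc, h]
    exact ⟨_, _, rfl⟩
  | pop1 w hw =>
    rw [← List.append_assoc] at hs ⊢
    obtain ⟨u, rest, h⟩ := top2_of hw l (run0_prefix _ _ hs)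
    unfold Top2
    rw [run0_snoc, h] at hs ⊢
    cases u with
    | nil => simp [step] at hs
    | cons c u => exact ⟨_, _, rfl⟩
  | pop2 v w hv hw =>
    simp only [← List.append_assoc] at hs ⊢
    have hs1 := run0_prefix _ _ hs
    have h := top2_of hv l (run0_prefix _ _ hs1)
    unfold Top2 at h ⊢
    rw [pop2_run (List.prefix_append _ _) (top2_of hw (l ++ v) hs1) hs]
    exact h
  | collapse v w x hv hw hx =>
    simp only [← List.append_assoc] at hs ⊢
    have hs1 := run0_prefix _ _ hs
    have hs2 := run0_prefix _ _ hs1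
    have h := top2_of hv l (run0_prefix _ _ hs2)
    unfold Top2 at h ⊢
    rw [collapse_run (List.prefix_append _ _) (List.prefix_append _ _)
      (top2_of hw (l ++ v) hs2) (top1_of hx (l ++ v ++ w) hs1) hs]
    exact h
  termination_by w.length
  decreasing_by all_goals (subst_vars; simp; try omega)
end

theorem take_factor {S : Type} (ops : List (Op S)) (i j : ℕ) (h : i ≤ j) :
    ops.take i ++ factor ops i j = ops.take (j + 1) := by
  unfold factor
  rw [← List.take_add]
  congr 1
  omega

/-- In a valid sequence, for every `0 ≤ j ≤ n` there is at most one
`0 ≤ i ≤ j` with `op_i ⋯ op_j ∈ L1`, and at most one `0 ≤ i ≤ j` with `op_i ⋯ op_j ∈ L2`. -/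
theorem unique_factor_L1_L2 {S : Type} (ops : List (Op S)) (hv : Valid ops)
    (j : ℕ) (hj : j < ops.length) :
    (∀ i₁ i₂ : ℕ, i₁ ≤ j → i₂ ≤ j →
      InL1 (factor ops i₁ j) → InL1 (factor ops i₂ j) → i₁ = i₂) ∧
    (∀ i₁ i₂ : ℕ, i₁ ≤ j → i₂ ≤ j →
      InL2 (factor ops i₁ j) → InL2 (factor ops i₂ j) → i₁ = i₂) := by
  have hs : (run0 (ops.take (j + 1))).isSome := by
    apply run0_prefix _ (ops.drop (j + 1))
    rw [List.take_append_drop]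
    exact hv.2
  constructor
  · intro i₁ i₂ h₁ h₂ w₁ w₂
    have e₁ := take_factor ops i₁ j h₁
    have e₂ := take_factor ops i₂ j h₂
    obtain ⟨a, s, n, v, r, t₁⟩ := top1_of w₁ (ops.take i₁) (by rw [e₁]; exact hs)
    obtain ⟨a', s', n', v', r', t₂⟩ := top1_of w₂ (ops.take i₂) (by rw [e₂]; exact hs)
    rw [e₁] at t₁
    rw [e₂, t₁] at t₂
    simp only [Option.some.injEq, List.cons.injEq, Prod.mk.injEq, List.length_take] at t₂
    omega
  · intro i₁ i₂ h₁ h₂ w₁ w₂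
    have e₁ := take_factor ops i₁ j h₁
    have e₂ := take_factor ops i₂ j h₂
    obtain ⟨v, r, t₁⟩ := top2_of w₁ (ops.take i₁) (by rw [e₁]; exact hs)
    obtain ⟨v', r', t₂⟩ := top2_of w₂ (ops.take i₂) (by rw [e₂]; exact hs)
    rw [e₁] at t₁
    rw [e₂, t₁] at t₂
    simp only [Option.some.injEq, List.cons.injEq, Prod.mk.injEq, List.length_take] at t₂
    omega
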